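/- Let (ℱ_t)_{t∈ℕ} be a filtration on a probability space (Ω, ℱ, ℙ) and let l^{(1)} be a binary-valued process adapted to (ℱ_t) such that for some p₀^{(1)}, p₁^{(1)} ∈ [0,1] and every t ∈ ℕ, ℙ[ l^{(1)}(t+1) = 0 ∣ ℱ_t ] ≤ p₀^{(1)} a.s. and ℙ[ l^{(1)}(t+1) = 1 ∣ ℱ_t ] ≤ p₁^{(1)} a.s. Let l^{(2)} be a binary-valued process with l^{(2)} ∈ Λ_{ρ^{(2)}} for some ρ^{(2)} ∈ [0,1], such that the σ-algebra generated by (l^{(2)}(t))_{t∈ℕ} is independent of ℱ_∞ = σ(⋃_t ℱ_t), and assume p₁^{(1)} + p₀^{(1)} ρ^{(2)} < 1. Then the process l̃ defined by l̃(t) := l^{(1)}(t) ∨ l^{(2)}(t) satisfies l̃ ∈ Λ_{ρ̃} for every ρ̃ ∈ (p₁^{(1)} + p₀^{(1)} ρ^{(2)}, 1]. -/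

import Mathlib

open MeasureTheory Filter Set ProbabilityTheory

/-- A binary-valued process `l` belongs to the class `Λ_ρ` if
`∑_{k=1}^∞ ℙ[∑_{t=0}^{k-1} l(t) > ρ k] < ∞`. -/
def MemLambda {Ω : Type*} [MeasurableSpace Ω] (μ : Measure Ω)
    (l : ℕ → Ω → ℕ) (ρ : ℝ) : Prop :=
  ∑' k : ℕ,
    μ {ω | ρ * ((k : ℝ) + 1) < ∑ t ∈ Finset.range (k + 1), (l t ω : ℝ)} < ⊤

lemma aux_condexp {Ω : Type*} {m m0 : MeasurableSpace Ω} {μ : Measure Ω}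
    [IsProbabilityMeasure μ] (hm : m ≤ m0) (W f : Ω → ℝ) (p C : ℝ)
    (hW : StronglyMeasurable[m] W) (hW0 : ∀ ω, 0 ≤ W ω) (hWC : ∀ ω, W ω ≤ C)
    (hf : Integrable f μ)
    (h : ∀ᵐ ω ∂μ, (μ[f | m]) ω ≤ p) : ∫ ω, W ω * f ω ∂μ ≤ p * ∫ ω, W ω ∂μ := by
  have hWm : AEStronglyMeasurable W μ := (hW.mono hm).aestronglyMeasurable
  have hWb : ∀ᵐ ω ∂μ, ‖W ω‖ ≤ C := Eventually.of_forall fun ω => by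
    rw [Real.norm_of_nonneg (hW0 ω)]; exact hWC ω
  have hWi : Integrable W μ := Integrable.of_bound hWm C hWb
  have hWf : Integrable (W * f) μ := hf.bdd_mul hWm hWb
  have hWc : Integrable (fun ω => W ω * (μ[f|m]) ω) μ := integrable_condExp.bdd_mul hWm hWb
  have h1 : μ[W * f | m] =ᵐ[μ] W * μ[f | m] := condExp_mul_of_stronglyMeasurable_left hW hWf hf
  calc ∫ ω, W ω * f ω ∂μ = ∫ ω, (μ[W * f | m]) ω ∂μ := (integral_condExp hm).symm
    _ = ∫ ω, W ω * (μ[f|m]) ω ∂μ := integral_congr_ae h1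
    _ ≤ ∫ ω, p * W ω ∂μ := by
        refine integral_mono_ae hWc (hWi.const_mul p) ?_
        filter_upwards [h] with ω hω
        have := mul_le_mul_of_nonneg_left hω (hW0 ω)
        simpa [mul_comm] using this
    _ = p * ∫ ω, W ω ∂μ := integral_const_mul _ _

lemma aux_mgf {Ω : Type*} {m0 : MeasurableSpace Ω} {μ : Measure Ω}
    [IsProbabilityMeasure μ] (ℱ : Filtration ℕ m0)
    (l1 : ℕ → Ω → ℕ) (hbin1 : ∀ t ω, l1 t ω ≤ 1)
    (hadp1 : ∀ t, Measurable[ℱ t] (l1 t))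
    {p01 p11 : ℝ}
    (hcond0 : ∀ t, ∀ᵐ ω ∂μ,
      (μ[Set.indicator {ω' | l1 (t + 1) ω' = 0} (fun _ => (1 : ℝ)) | ℱ t]) ω ≤ p01)
    (hcond1 : ∀ t, ∀ᵐ ω ∂μ,
      (μ[Set.indicator {ω' | l1 (t + 1) ω' = 1} (fun _ => (1 : ℝ)) | ℱ t]) ω ≤ p11)
    (y : ℕ → ℕ) (hy : ∀ t, y t ≤ 1) (s : ℝ) (hs : 0 ≤ s) (hs1 : s ≤ 1) (k : ℕ) :
    Integrable (fun ω => Real.exp (s * ∑ t ∈ Finset.range (k + 1), ((max (l1 t ω) (y t) : ℕ) : ℝ))) μ ∧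
    ∫ ω, Real.exp (s * ∑ t ∈ Finset.range (k + 1), ((max (l1 t ω) (y t) : ℕ) : ℝ)) ∂μ
      ≤ Real.exp (s + ∑ t ∈ Finset.range k, (s * (p11 + p01 * y (t + 1)) + s ^ 2)) := by
  have hz1 : ∀ t ω, ((max (l1 t ω) (y t) : ℕ) : ℝ) ≤ 1 := fun t ω => by
    exact_mod_cast max_le (hbin1 t ω) (hy t)
  set W : ℕ → Ω → ℝ := fun k ω =>
    Real.exp (s * ∑ t ∈ Finset.range (k + 1), ((max (l1 t ω) (y t) : ℕ) : ℝ)) with hWdef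
  have hWm : ∀ k, StronglyMeasurable[ℱ k] (W k) := by
    intro k
    refine Measurable.stronglyMeasurable (Real.measurable_exp.comp ?_)
    refine Measurable.const_mul (Finset.measurable_sum _ ?_) s
    intro t ht
    have h1 : Measurable[ℱ k] (l1 t) :=
      (hadp1 t).mono (ℱ.mono (by simpa [Nat.lt_succ_iff] using ht)) le_rfl
    exact (measurable_from_top (f := fun n : ℕ => ((max n (y t) : ℕ) : ℝ))).comp h1
  have hW0 : ∀ k ω, 0 ≤ W k ω := fun k ω => (Real.exp_pos _).le
  have hWC : ∀ k ω, W k ω ≤ Real.exp (s * (k + 1)) := by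
    intro k ω
    refine Real.exp_le_exp.2 (mul_le_mul_of_nonneg_left ?_ hs)
    calc _ ≤ ∑ t ∈ Finset.range (k + 1), (1 : ℝ) := Finset.sum_le_sum fun t _ => hz1 t ω
      _ = _ := by simp
  have hWi : ∀ k, Integrable (W k) μ := fun k =>
    Integrable.of_bound ((hWm k).mono (ℱ.le k)).aestronglyMeasurable (Real.exp (s * (k + 1)))
      (Eventually.of_forall fun ω => by rw [Real.norm_of_nonneg (hW0 k ω)]; exact hWC k ω)
  refine ⟨hWi k, ?_⟩
  change ∫ ω, W k ω ∂μ ≤ _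
  induction k with
  | zero =>
    calc ∫ ω, W 0 ω ∂μ ≤ ∫ ω, Real.exp s ∂μ := by
          refine integral_mono (hWi 0) (integrable_const _) fun ω => ?_
          have := hWC 0 ω
          simpa using this
      _ = _ := by simp
  | succ k ih =>
    have hset : ∀ j, MeasurableSet {ω' | l1 (k + 1) ω' = j} := fun j =>
      ((hadp1 (k+1)).mono (ℱ.le _) le_rfl) (measurableSet_singleton j)
    set f1 : Ω → ℝ := Set.indicator {ω' | l1 (k + 1) ω' = 1} (fun _ => (1 : ℝ)) with hf1
    set f0 : Ω → ℝ := Set.indicator {ω' | l1 (k + 1) ω' = 0} (fun _ => (1 : ℝ)) with hf0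
    have hf1i : Integrable f1 μ := (integrable_const 1).indicator (hset 1)
    have hf0i : Integrable f0 μ := (integrable_const 1).indicator (hset 0)
    have A1 := aux_condexp (ℱ.le k) (W k) f1 p11 _ (hWm k) (hW0 k) (hWC k) hf1i (hcond1 k)
    have A0 := aux_condexp (ℱ.le k) (W k) f0 p01 _ (hWm k) (hW0 k) (hWC k) hf0i (hcond0 k)
    have hb : ∀ᵐ ω ∂μ, ‖W k ω‖ ≤ Real.exp (s * (k + 1)) :=
      Eventually.of_forall fun ω => by rw [Real.norm_of_nonneg (hW0 k ω)]; exact hWC k ω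
    have hWf1 : Integrable (fun ω => W k ω * f1 ω) μ := hf1i.bdd_mul (hWi k).1 hb
    have hWf0 : Integrable (fun ω => W k ω * f0 ω) μ := hf0i.bdd_mul (hWi k).1 hb
    have hpt : ∀ ω, W (k+1) ω ≤
        (1 + s^2) * W k ω + (s * (W k ω * f1 ω) + s * y (k+1) * (W k ω * f0 ω)) := by
      intro ω
      have e1 : W (k+1) ω = W k ω * Real.exp (s * ((max (l1 (k+1) ω) (y (k+1)) : ℕ) : ℝ)) := by
        simp only [hWdef]
        rw [Finset.sum_range_succ _ (k+1), mul_add, Real.exp_add]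
      have e2 : Real.exp (s * ((max (l1 (k+1) ω) (y (k+1)) : ℕ) : ℝ)) ≤
          (1 + s^2) + (s * f1 ω + s * y (k+1) * f0 ω) := by
        have hexp : Real.exp s ≤ 1 + s + s^2 := by
          have := Real.abs_exp_sub_one_sub_id_le (x := s) (by rwa [abs_of_nonneg hs])
          have := (abs_le.1 this).2
          linarith
        have c1 := hbin1 (k+1) ω
        have c2 := hy (k+1)
        have d1 : l1 (k+1) ω = 0 ∨ l1 (k+1) ω = 1 := by omega
        have d2 : y (k+1) = 0 ∨ y (k+1) = 1 := by omega
        rcases d1 with d1 | d1 <;> rcases d2 with d2 | d2 <;>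
          simp [hf1, hf0, Set.indicator, d1, d2] <;> nlinarith [sq_nonneg s]
      rw [e1]
      have := mul_le_mul_of_nonneg_left e2 (hW0 k ω)
      linarith
    have hmono := integral_mono (hWi (k+1))
      (((hWi k).const_mul (1 + s^2)).add ((hWf1.const_mul s).add (hWf0.const_mul (s * y (k+1))))) hpt
    simp only [Pi.add_apply] at hmono
    have hadd : Integrable (fun ω => s * (W k ω * f1 ω) + s * y (k+1) * (W k ω * f0 ω)) μ :=
      (hWf1.const_mul s).add (hWf0.const_mul (s * y (k+1)))
    rw [integral_add ((hWi k).const_mul _) hadd,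
      integral_add (hWf1.const_mul s) (hWf0.const_mul (s * y (k+1))),
      integral_const_mul, integral_const_mul, integral_const_mul] at hmono
    have hI0 : 0 ≤ ∫ ω, W k ω ∂μ := integral_nonneg (hW0 k)
    have hy0 : (0:ℝ) ≤ s * y (k+1) := by positivity
    have B1 := mul_le_mul_of_nonneg_left A1 hs
    have B0 := mul_le_mul_of_nonneg_left A0 hy0
    have hfin : ∫ ω, W (k+1) ω ∂μ ≤
        (∫ ω, W k ω ∂μ) * ((s * (p11 + p01 * y (k + 1)) + s ^ 2) + 1) := by
      linarith
    refine hfin.trans ?_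
    rw [Finset.sum_range_succ, ← add_assoc, Real.exp_add]
    refine (mul_le_mul_of_nonneg_left (Real.add_one_le_exp _) hI0).trans ?_
    exact mul_le_mul_of_nonneg_right ih (Real.exp_pos _).le

lemma aux_tail {Ω : Type*} {m0 : MeasurableSpace Ω} {μ : Measure Ω}
    [IsProbabilityMeasure μ] (ℱ : Filtration ℕ m0)
    (l1 : ℕ → Ω → ℕ) (hbin1 : ∀ t ω, l1 t ω ≤ 1)
    (hadp1 : ∀ t, Measurable[ℱ t] (l1 t))
    {p01 p11 : ℝ} (hp01 : p01 ∈ Set.Icc (0 : ℝ) 1) (hp11 : p11 ∈ Set.Icc (0 : ℝ) 1)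
    (hcond0 : ∀ t, ∀ᵐ ω ∂μ,
      (μ[Set.indicator {ω' | l1 (t + 1) ω' = 0} (fun _ => (1 : ℝ)) | ℱ t]) ω ≤ p01)
    (hcond1 : ∀ t, ∀ᵐ ω ∂μ,
      (μ[Set.indicator {ω' | l1 (t + 1) ω' = 1} (fun _ => (1 : ℝ)) | ℱ t]) ω ≤ p11)
    (y : ℕ → ℕ) (hy : ∀ t, y t ≤ 1) (s : ℝ) (hs : 0 ≤ s) (hs1 : s ≤ 1) (k : ℕ)
    (ρ ρ2 : ℝ) (hysum : ∑ t ∈ Finset.range (k + 1), (y t : ℝ) ≤ ρ2 * ((k : ℝ) + 1)) :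
    μ {ω | ρ * ((k : ℝ) + 1) < ∑ t ∈ Finset.range (k + 1), ((max (l1 t ω) (y t) : ℕ) : ℝ)} ≤
      ENNReal.ofReal (Real.exp (s + (k + 1) * (s ^ 2 - s * (ρ - (p11 + p01 * ρ2))))) := by
  obtain ⟨hi, hle⟩ := aux_mgf ℱ l1 hbin1 hadp1 hcond0 hcond1 y hy s hs hs1 k
  have hch := measure_ge_le_exp_mul_mgf (μ := μ)
    (X := fun ω => ∑ t ∈ Finset.range (k + 1), ((max (l1 t ω) (y t) : ℕ) : ℝ))
    (ρ * ((k : ℝ) + 1)) hs hi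
  rw [← ofReal_measureReal]
  refine ENNReal.ofReal_le_ofReal ?_
  refine le_trans (measureReal_mono ?_ (measure_ne_top _ _)) (hch.trans ?_)
  · intro ω hω
    rw [Set.mem_ofPred_eq] at hω ⊢
    exact hω.le
  refine (mul_le_mul_of_nonneg_left hle (Real.exp_pos _).le).trans ?_
  rw [← Real.exp_add]
  refine Real.exp_le_exp.2 ?_
  have h1 : ∑ t ∈ Finset.range k, (s * (p11 + p01 * y (t + 1)) + s ^ 2) =
      k * (s * p11 + s ^ 2) + s * p01 * ∑ t ∈ Finset.range k, (y (t+1) : ℝ) := by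
    rw [Finset.mul_sum, ← nsmul_eq_mul, ← Finset.card_range k, ← Finset.sum_const,
      Finset.card_range, ← Finset.sum_add_distrib]
    exact Finset.sum_congr rfl fun t _ => by ring
  have h2 : ∑ t ∈ Finset.range k, (y (t+1) : ℝ) ≤ ρ2 * ((k : ℝ) + 1) := by
    rw [Finset.sum_range_succ'] at hysum
    have : (0:ℝ) ≤ y 0 := by positivity
    linarith
  have h3 := mul_le_mul_of_nonneg_left h2 (mul_nonneg hs hp01.1)
  have h4 := mul_nonneg hs hp11.1
  rw [h1]
  nlinarith [sq_nonneg s]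

/-- Theorem 4.3 (filtration form): if `l⁽¹⁾` satisfies the `Γ`-type conditional
bounds `ℙ[l⁽¹⁾(t+1)=0 ∣ ℱ_t] ≤ p₀⁽¹⁾` and `ℙ[l⁽¹⁾(t+1)=1 ∣ ℱ_t] ≤ p₁⁽¹⁾` a.s.,
`l⁽²⁾ ∈ Λ_{ρ⁽²⁾}` is independent of `ℱ_∞`, and `p₁⁽¹⁾ + p₀⁽¹⁾ ρ⁽²⁾ < 1`, then
`l̃(t) = l⁽¹⁾(t) ∨ l⁽²⁾(t)` satisfies `l̃ ∈ Λ_ρ̃` for every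
`ρ̃ ∈ (p₁⁽¹⁾ + p₀⁽¹⁾ ρ⁽²⁾, 1]`. -/
theorem or_gamma_lambda {Ω : Type*} {m0 : MeasurableSpace Ω} {μ : Measure Ω}
    [IsProbabilityMeasure μ] (ℱ : Filtration ℕ m0)
    (l1 : ℕ → Ω → ℕ) (hbin1 : ∀ t ω, l1 t ω ≤ 1)
    (hadp1 : ∀ t, Measurable[ℱ t] (l1 t))
    {p01 p11 : ℝ} (hp01 : p01 ∈ Set.Icc (0 : ℝ) 1) (hp11 : p11 ∈ Set.Icc (0 : ℝ) 1)
    (hcond0 : ∀ t, ∀ᵐ ω ∂μ,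
      (μ[Set.indicator {ω' | l1 (t + 1) ω' = 0} (fun _ => (1 : ℝ)) | ℱ t]) ω ≤ p01)
    (hcond1 : ∀ t, ∀ᵐ ω ∂μ,
      (μ[Set.indicator {ω' | l1 (t + 1) ω' = 1} (fun _ => (1 : ℝ)) | ℱ t]) ω ≤ p11)
    (l2 : ℕ → Ω → ℕ) (hbin2 : ∀ t ω, l2 t ω ≤ 1) (hmeas2 : ∀ t, Measurable (l2 t))
    {ρ2 : ℝ} (hρ2 : ρ2 ∈ Set.Icc (0 : ℝ) 1) (hl2 : MemLambda μ l2 ρ2)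
    (hindep : Indep (⨆ t, MeasurableSpace.comap (l2 t) inferInstance)
      (⨆ t, (ℱ t : MeasurableSpace Ω)) μ)
    (hlt : p11 + p01 * ρ2 < 1)
    {ρ : ℝ} (hρ : ρ ∈ Set.Ioc (p11 + p01 * ρ2) 1) :
    MemLambda μ (fun t ω => max (l1 t ω) (l2 t ω)) ρ := by
  classical
  obtain ⟨hρ1, hρle⟩ := hρ
  set δ : ℝ := ρ - (p11 + p01 * ρ2) with hδ
  have hδ0 : 0 < δ := by linarith
  have hδ1 : δ ≤ 1 := by
    have := mul_nonneg hp01.1 hρ2.1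
    have := hp11.1
    linarith
  have key : ∀ k : ℕ,
      μ {ω | ρ * ((k : ℝ) + 1) < ∑ t ∈ Finset.range (k + 1), ((max (l1 t ω) (l2 t ω) : ℕ) : ℝ)} ≤
      μ {ω | ρ2 * ((k : ℝ) + 1) < ∑ t ∈ Finset.range (k + 1), (l2 t ω : ℝ)} +
        ENNReal.ofReal (Real.exp (1 + (k + 1) * (-(δ ^ 2 / 4)))) := by
    intro k
    set c := ENNReal.ofReal (Real.exp (1 + (k + 1) * (-(δ ^ 2 / 4)))) with hc
    let y : Finset ℕ → ℕ → ℕ := fun A t => if t ∈ A then 1 else 0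
    let E : Finset ℕ → Set Ω := fun A => ⋂ t ∈ Finset.range (k + 1), l2 t ⁻¹' {y A t}
    let B : Finset ℕ → Set Ω := fun A =>
      {ω | ρ * ((k : ℝ) + 1) < ∑ t ∈ Finset.range (k + 1), ((max (l1 t ω) (y A t) : ℕ) : ℝ)}
    let S : Finset (Finset ℕ) := (Finset.range (k + 1)).powerset.filter
      (fun A => ∑ t ∈ Finset.range (k + 1), (y A t : ℝ) ≤ ρ2 * ((k : ℝ) + 1))
    have hsub : {ω | ρ * ((k : ℝ) + 1) <
          ∑ t ∈ Finset.range (k + 1), ((max (l1 t ω) (l2 t ω) : ℕ) : ℝ)} ⊆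
        {ω | ρ2 * ((k : ℝ) + 1) < ∑ t ∈ Finset.range (k + 1), (l2 t ω : ℝ)} ∪
          ⋃ A ∈ S, (E A ∩ B A) := by
      intro ω hω
      rw [Set.mem_ofPred_eq] at hω
      by_cases h : ρ2 * ((k : ℝ) + 1) < ∑ t ∈ Finset.range (k + 1), (l2 t ω : ℝ)
      · exact Or.inl h
      · right
        let A := (Finset.range (k + 1)).filter (fun t => l2 t ω = 1)
        have hA : ∀ t ∈ Finset.range (k + 1), l2 t ω = y A t := by
          intro t ht
          have := hbin2 t ω
          by_cases h1 : l2 t ω = 1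
          · simp only [y, A, Finset.mem_filter, ht, h1, and_self, if_true]
          · simp only [y, A, Finset.mem_filter, h1, and_false, if_false]
            omega
        simp only [Set.mem_iUnion]
        refine ⟨A, ?_, ?_, ?_⟩
        · refine Finset.mem_filter.2 ⟨Finset.mem_powerset.2 (Finset.filter_subset _ _), ?_⟩
          have e : ∑ t ∈ Finset.range (k + 1), (l2 t ω : ℝ) =
              ∑ t ∈ Finset.range (k + 1), (y A t : ℝ) :=
            Finset.sum_congr rfl fun t ht => by rw [hA t ht]
          rw [← e]
          exact not_lt.1 h
        · simp only [E, Set.mem_iInter]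
          exact hA
        · simp only [B, Set.mem_ofPred_eq]
          have e : ∑ t ∈ Finset.range (k + 1), ((max (l1 t ω) (l2 t ω) : ℕ) : ℝ) =
              ∑ t ∈ Finset.range (k + 1), ((max (l1 t ω) (y A t) : ℕ) : ℝ) :=
            Finset.sum_congr rfl fun t ht => by rw [hA t ht]
          rw [← e]
          exact hω
    have hE2 : ∀ A, MeasurableSet[⨆ t, MeasurableSpace.comap (l2 t) inferInstance] (E A) := by
      intro A
      refine Finset.measurableSet_biInter _ fun t _ => ?_
      exact le_iSup (fun t => MeasurableSpace.comap (l2 t) inferInstance) t _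
        ⟨{y A t}, measurableSet_singleton _, rfl⟩
    have hE : ∀ A, MeasurableSet (E A) := by
      intro A
      exact Finset.measurableSet_biInter _ fun t _ => hmeas2 t (measurableSet_singleton _)
    have hB : ∀ A, MeasurableSet[⨆ t, (ℱ t : MeasurableSpace Ω)] (B A) := by
      intro A
      refine measurableSet_lt (mδ := ⨆ t, (ℱ t : MeasurableSpace Ω)) measurable_const ?_
      refine Finset.measurable_sum _ fun t _ => ?_
      have h1 : Measurable[⨆ t, (ℱ t : MeasurableSpace Ω)] (l1 t) :=
        (hadp1 t).mono (le_iSup (fun t => (ℱ t : MeasurableSpace Ω)) t) le_rfl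
      exact (measurable_from_top (f := fun n : ℕ => ((max n (y A t) : ℕ) : ℝ))).comp h1
    have hBc : ∀ A ∈ S, μ (B A) ≤ c := by
      intro A hA
      have := aux_tail (μ := μ) ℱ l1 hbin1 hadp1 hp01 hp11 hcond0 hcond1 (y A)
        (fun t => by simp only [y]; split_ifs <;> simp) (δ / 2) (by linarith) (by linarith) k ρ ρ2
        (Finset.mem_filter.1 hA).2
      refine this.trans (ENNReal.ofReal_le_ofReal (Real.exp_le_exp.2 ?_))
      rw [← hδ]
      have : (δ / 2) ^ 2 - δ / 2 * δ = -(δ ^ 2 / 4) := by ring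
      rw [this]
      linarith
    have hdisj : Set.PairwiseDisjoint (S : Set (Finset ℕ)) E := by
      intro A hA A' hA' hne
      refine Set.disjoint_left.2 fun ω h h' => hne ?_
      simp only [E, Set.mem_iInter, Set.mem_preimage, Set.mem_singleton_iff] at h h'
      have s1 := Finset.mem_powerset.1 (Finset.mem_filter.1 hA).1
      have s2 := Finset.mem_powerset.1 (Finset.mem_filter.1 hA').1
      ext t
      by_cases ht : t ∈ Finset.range (k + 1)
      · have e := (h t ht).symm.trans (h' t ht)
        simp only [y] at e
        split_ifs at e <;> simp_all
      · exact ⟨fun q => absurd (s1 q) ht, fun q => absurd (s2 q) ht⟩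
    refine (measure_mono hsub).trans ((measure_union_le _ _).trans ?_)
    refine add_le_add le_rfl ?_
    calc μ (⋃ A ∈ S, (E A ∩ B A)) ≤ ∑ A ∈ S, μ (E A ∩ B A) := measure_biUnion_finset_le _ _
      _ ≤ ∑ A ∈ S, μ (E A) * c := by
          refine Finset.sum_le_sum fun A hA => ?_
          rw [(Indep_iff _ _ μ).1 hindep (E A) (B A) (hE2 A) (hB A)]
          exact mul_le_mul_right (hBc A hA) _
      _ = μ (⋃ A ∈ S, E A) * c := by
          rw [← Finset.sum_mul, measure_biUnion_finset hdisj (fun A _ => hE A)]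
      _ ≤ 1 * c := mul_le_mul_left prob_le_one c
      _ = c := one_mul c
  unfold MemLambda at hl2 ⊢
  refine (ENNReal.tsum_le_tsum key).trans_lt ?_
  rw [ENNReal.tsum_add]
  refine ENNReal.add_lt_top.2 ⟨hl2, ?_⟩
  have hsm : Summable (fun k : ℕ => Real.exp (1 + ((k:ℝ) + 1) * (-(δ ^ 2 / 4)))) := by
    have h1 : Summable (fun k : ℕ => Real.exp (k * (-(δ ^ 2 / 4)))) :=
      Real.summable_exp_nat_mul_iff.2 (by have := pow_pos hδ0 2; linarith)
    refine (h1.mul_left (Real.exp (1 + (-(δ ^ 2 / 4))))).congr fun k => ?_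
    rw [← Real.exp_add]
    congr 1
    ring
  rw [← ENNReal.ofReal_tsum_of_nonneg (fun _ => (Real.exp_pos _).le) hsm]
  exact ENNReal.ofReal_lt_top
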